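/- Fix 0 < s < 1, k ∈ ℤ, ξ ∈ ℝ, and define B_{n,k}(ξ) = (1/2π) ∫₀^{2π} e^{ikθ} Tₙ(s cos(θ + ξ/n)) U_{n−1}(s cos θ) dθ and C_{n,k}(ξ) = (1/2π) ∫₀^{2π} e^{ikθ} U_{n−1}(s cos(θ + ξ/n)) Tₙ(s cos θ) dθ. Then lim_{n→∞} B_{n,k}(ξ) = −lim_{n→∞} C_{n,k}(ξ) = −((1 − (−1)ᵏ)/(4π)) ∫_{−s}^{s} e_k(x) sin(ξ √(s² − x²)/√(1 − x²)) dx/√((1 − x²)(s² − x²)), where e_k(x) = exp(i k arccos(x/s)). -/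

import Mathlib

/-- `e_k(x) = exp(i k arccos(x/s))`. -/
noncomputable def ek (s : ℝ) (k : ℤ) (x : ℝ) : ℂ :=
  Complex.exp (Complex.I * k * Real.arccos (x / s))

/-- `B_{n,k}(ξ) = (1/2π) ∫₀^{2π} e^{ikθ} Tₙ(s cos(θ + ξ/n)) U_{n−1}(s cos θ) dθ`. -/
noncomputable def Bnk (s : ℝ) (k : ℤ) (ξ : ℝ) (n : ℕ) : ℂ :=
  ((1 / (2 * Real.pi) : ℝ) : ℂ) * ∫ θ in (0:ℝ)..(2 * Real.pi),
    Complex.exp (Complex.I * k * θ) *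
      Complex.ofReal ((Polynomial.Chebyshev.T ℝ (n : ℤ)).eval (s * Real.cos (θ + ξ / n))) *
      Complex.ofReal ((Polynomial.Chebyshev.U ℝ ((n : ℤ) - 1)).eval (s * Real.cos θ))

/-- `C_{n,k}(ξ) = (1/2π) ∫₀^{2π} e^{ikθ} U_{n−1}(s cos(θ + ξ/n)) Tₙ(s cos θ) dθ`. -/
noncomputable def Cnk (s : ℝ) (k : ℤ) (ξ : ℝ) (n : ℕ) : ℂ :=
  ((1 / (2 * Real.pi) : ℝ) : ℂ) * ∫ θ in (0:ℝ)..(2 * Real.pi),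
    Complex.exp (Complex.I * k * θ) *
      Complex.ofReal ((Polynomial.Chebyshev.U ℝ ((n : ℤ) - 1)).eval (s * Real.cos (θ + ξ / n))) *
      Complex.ofReal ((Polynomial.Chebyshev.T ℝ (n : ℤ)).eval (s * Real.cos θ))

open Filter Topology MeasureTheory Set

/-- Riemann–Lebesgue lemma for an injective phase without critical points. -/
theorem tendsto_setIntegral_exp_phase_mul {S : Set ℝ} (hS : MeasurableSet S) {f f' : ℝ → ℝ}
    (hf : ∀ x ∈ S, HasDerivWithinAt f (f' x) S x) (hinj : InjOn f S) (hf' : ∀ x ∈ S, f' x ≠ 0)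
    (g : ℝ → ℂ) :
    Tendsto (fun t : ℝ => ∫ x in S, Complex.exp ((t * f x : ℝ) * Complex.I) * g x)
      (cocompact ℝ) (𝓝 0) := by
  set F : ℝ → ℂ := fun y =>
    ((|f' (Function.invFunOn f S y)|⁻¹ : ℝ) : ℂ) * g (Function.invFunOn f S y) with hF
  have hinv := hinj.leftInvOn_invFunOn
  have himg : MeasurableSet (f '' S) :=
    measurable_image_of_fderivWithin hS (fun x hx => (hf x hx).hasFDerivWithinAt) hinj
  have hRL := Real.tendsto_integral_exp_smul_cocompact ((f '' S).indicator F)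
  have hscale : Tendsto (fun t : ℝ => (-(2 * Real.pi))⁻¹ * t) (cocompact ℝ) (cocompact ℝ) :=
    tendsto_cocompact_mul_left₀ (by simp [Real.pi_ne_zero])
  refine (hRL.comp hscale).congr fun t => ?_
  have hind : ∀ v : ℝ, Real.fourierChar (-(v * ((-(2 * Real.pi))⁻¹ * t))) • (f '' S).indicator F v
      = (f '' S).indicator (fun v => Complex.exp ((t * v : ℝ) * Complex.I) * F v) v := by
    intro v
    have hphase : 2 * Real.pi * (-(v * ((-(2 * Real.pi))⁻¹ * t))) = t * v := by
      field_simp [Real.pi_ne_zero]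
    by_cases hv : v ∈ f '' S
    · rw [indicator_of_mem hv, indicator_of_mem hv, Circle.smul_def, Real.fourierChar_apply,
        hphase, smul_eq_mul]
    · rw [indicator_of_notMem hv, indicator_of_notMem hv, smul_zero]
  simp only [Function.comp_apply, hind]
  rw [integral_indicator himg, integral_image_eq_integral_abs_deriv_smul hS hf hinj]
  refine setIntegral_congr_fun hS fun x hx => ?_
  have hne : ((|f' x| : ℝ) : ℂ) ≠ 0 := by exact_mod_cast abs_ne_zero.2 (hf' x hx)
  simp only [hF, hinv hx, Complex.real_smul, Complex.ofReal_inv]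
  field_simp

namespace ChebyshevPhase

/-- The angle `φ(θ)` with `cos φ(θ) = s cos θ`. -/
noncomputable def phase (s θ : ℝ) : ℝ := Real.arccos (s * Real.cos θ)

/-- The derivative of `phase s`. -/
noncomputable def phaseDeriv (s θ : ℝ) : ℝ :=
  s * Real.sin θ / Real.sqrt (1 - (s * Real.cos θ) ^ 2)

variable {s : ℝ}

theorem abs_mul_cos_le (hs0 : 0 < s) (θ : ℝ) : |s * Real.cos θ| ≤ s := by
  rw [abs_mul, abs_of_pos hs0]
  exact mul_le_of_le_one_right hs0.le (Real.abs_cos_le_one θ)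

theorem cos_phase (hs0 : 0 < s) (hs1 : s < 1) (θ : ℝ) :
    Real.cos (phase s θ) = s * Real.cos θ := by
  have h := abs_le.1 (abs_mul_cos_le hs0 θ)
  exact Real.cos_arccos (by linarith) (by linarith)

theorem sin_phase (θ : ℝ) :
    Real.sin (phase s θ) = Real.sqrt (1 - (s * Real.cos θ) ^ 2) := Real.sin_arccos _

theorem sqrt_le_sin_phase (hs0 : 0 < s) (θ : ℝ) :
    Real.sqrt (1 - s ^ 2) ≤ Real.sin (phase s θ) := by
  rw [sin_phase]
  have := sq_le_sq' (abs_le.1 (abs_mul_cos_le hs0 θ)).1 (abs_le.1 (abs_mul_cos_le hs0 θ)).2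
  exact Real.sqrt_le_sqrt (by linarith)

theorem sqrt_one_sub_sq_pos (hs0 : 0 < s) (hs1 : s < 1) : 0 < Real.sqrt (1 - s ^ 2) :=
  Real.sqrt_pos.2 (by nlinarith)

theorem sin_phase_pos (hs0 : 0 < s) (hs1 : s < 1) (θ : ℝ) : 0 < Real.sin (phase s θ) :=
  (sqrt_one_sub_sq_pos hs0 hs1).trans_le (sqrt_le_sin_phase hs0 θ)

theorem continuous_phase : Continuous (phase s) := by
  unfold phase
  fun_prop

theorem hasDerivAt_phase (hs0 : 0 < s) (hs1 : s < 1) (θ : ℝ) :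
    HasDerivAt (phase s) (phaseDeriv s θ) θ := by
  have h := abs_le.1 (abs_mul_cos_le hs0 θ)
  have := (Real.hasDerivAt_arccos (x := s * Real.cos θ) (by linarith) (by linarith)).comp θ
    ((Real.hasDerivAt_cos θ).const_mul s)
  refine this.congr_deriv ?_
  rw [phaseDeriv]
  ring

theorem continuous_phaseDeriv (hs0 : 0 < s) (hs1 : s < 1) : Continuous (phaseDeriv s) := by
  unfold phaseDeriv
  refine Continuous.div (by fun_prop) (by fun_prop) fun θ => ?_
  rw [← sin_phase]
  exact (sin_phase_pos hs0 hs1 θ).ne'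

theorem injOn_phase (hs0 : 0 < s) (hs1 : s < 1) {S : Set ℝ} (hS : InjOn Real.cos S) :
    InjOn (phase s) S := by
  intro x hx y hy hxy
  refine hS hx hy (mul_left_cancel₀ hs0.ne' ?_)
  rw [← cos_phase hs0 hs1, ← cos_phase hs0 hs1, hxy]

theorem tendsto_setIntegral_exp_phase (hs0 : 0 < s) (hs1 : s < 1) {S : Set ℝ}
    (hS : MeasurableSet S) (hcos : InjOn Real.cos S) (hsin : ∀ x ∈ S, Real.sin x ≠ 0)
    (g : ℝ → ℂ) :
    Tendsto (fun t : ℝ => ∫ x in S, Complex.exp ((t * phase s x : ℝ) * Complex.I) * g x)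
      (cocompact ℝ) (𝓝 0) :=
  tendsto_setIntegral_exp_phase_mul hS
    (fun x _ => (hasDerivAt_phase hs0 hs1 x).hasDerivWithinAt) (injOn_phase hs0 hs1 hcos)
    (fun x hx => div_ne_zero (mul_ne_zero hs0.ne' (hsin x hx))
      (by rw [← sin_phase]; exact (sin_phase_pos hs0 hs1 x).ne')) g

theorem tendsto_integral_exp_phase (hs0 : 0 < s) (hs1 : s < 1) {g : ℝ → ℂ} (hg : Continuous g) :
    Tendsto (fun t : ℝ => ∫ x in (0:ℝ)..(2 * Real.pi),
      Complex.exp ((t * phase s x : ℝ) * Complex.I) * g x) (cocompact ℝ) (𝓝 0) := by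
  have hpi := Real.pi_pos
  have h₁ := tendsto_setIntegral_exp_phase hs0 hs1 (S := Ioo 0 Real.pi) measurableSet_Ioo
    (Real.injOn_cos.mono Ioo_subset_Icc_self) (fun x hx => (Real.sin_pos_of_mem_Ioo hx).ne') g
  have h₂ := tendsto_setIntegral_exp_phase hs0 hs1 (S := Ioo Real.pi (2 * Real.pi))
    measurableSet_Ioo (by
      intro x hx y hy hxy
      have := Real.injOn_cos (x₁ := 2 * Real.pi - x) (x₂ := 2 * Real.pi - y)
        ⟨by linarith [hx.2], by linarith [hx.1]⟩ ⟨by linarith [hy.2], by linarith [hy.1]⟩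
        (by simpa only [Real.cos_two_pi_sub] using hxy)
      linarith)
    (fun x hx => by
      have := Real.sin_pos_of_pos_of_lt_pi (x := 2 * Real.pi - x) (by linarith [hx.2])
        (by linarith [hx.1])
      rw [Real.sin_two_pi_sub] at this
      linarith) g
  have h := h₁.add h₂
  rw [add_zero] at h
  refine h.congr fun t => ?_
  have hc : Continuous fun x => Complex.exp ((t * phase s x : ℝ) * Complex.I) * g x := by
    have := continuous_phase (s := s)
    fun_prop
  rw [← intervalIntegral.integral_add_adjacent_intervals (hc.intervalIntegrable 0 Real.pi)
    (hc.intervalIntegrable Real.pi (2 * Real.pi)),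
    intervalIntegral.integral_of_le hpi.le, intervalIntegral.integral_of_le (by linarith),
    integral_Ioc_eq_integral_Ioo, integral_Ioc_eq_integral_Ioo]

theorem tendsto_integral_sin_phase (hs0 : 0 < s) (hs1 : s < 1) {a : ℝ → ℂ} (ha : Continuous a)
    {d : ℝ → ℝ} (hd : Continuous d) :
    Tendsto (fun n : ℕ => ∫ x in (0:ℝ)..(2 * Real.pi),
      a x * (Real.sin (2 * n * phase s x + d x) : ℂ)) atTop (𝓝 0) := by
  have hn : Tendsto (fun n : ℕ => (2 * n : ℝ)) atTop atTop :=
    tendsto_natCast_atTop_atTop.const_mul_atTop two_pos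
  have hg₁ : Continuous fun x => -(Complex.I / 2) * a x * Complex.exp (d x * Complex.I) := by
    fun_prop
  have hg₂ : Continuous fun x => (Complex.I / 2) * a x * Complex.exp (-d x * Complex.I) := by
    fun_prop
  have h := ((tendsto_integral_exp_phase hs0 hs1 hg₁).comp
      (hn.mono_right atTop_le_cocompact)).add
    ((tendsto_integral_exp_phase hs0 hs1 hg₂).comp
      ((tendsto_neg_atTop_atBot.comp hn).mono_right atBot_le_cocompact))
  rw [add_zero] at h
  refine h.congr fun n => ?_
  have hφ := continuous_phase (s := s)
  simp only [Function.comp_apply]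
  rw [← intervalIntegral.integral_add (Continuous.intervalIntegrable (by fun_prop) _ _)
    (Continuous.intervalIntegrable (by fun_prop) _ _)]
  refine intervalIntegral.integral_congr fun x _ => ?_
  simp only [Complex.ofReal_sin, Complex.sin]
  push_cast
  rw [show (-(2 * (n : ℂ) * phase s x + d x) * Complex.I)
      = (-(2 * n) * phase s x) * Complex.I + -d x * Complex.I by ring,
    show ((2 * (n : ℂ) * phase s x + d x) * Complex.I)
      = (2 * n * phase s x) * Complex.I + d x * Complex.I by ring, Complex.exp_add, Complex.exp_add]
  ring

section Perturbation

variable {a : ℕ → ℝ → ℂ} {a₀ : ℝ → ℂ} {δ : ℕ → ℝ → ℝ} {d : ℝ → ℝ} {M : ℝ}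

theorem tendsto_integral_mul_sin (ha : ∀ n, Continuous (a n)) (hδ : ∀ n, Continuous (δ n))
    (hM : ∀ n x, ‖a n x‖ ≤ M) (hlim : ∀ x, Tendsto (fun n => a n x) atTop (𝓝 (a₀ x)))
    (hδlim : ∀ x, Tendsto (fun n => δ n x) atTop (𝓝 (d x))) (p q : ℝ) :
    Tendsto (fun n => ∫ x in p..q, a n x * (Real.sin (δ n x) : ℂ)) atTop
      (𝓝 (∫ x in p..q, a₀ x * (Real.sin (d x) : ℂ))) := by
  refine intervalIntegral.tendsto_integral_filter_of_dominated_convergence (fun _ => M)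
    (Eventually.of_forall fun n => ?_) (Eventually.of_forall fun n => ae_of_all _ fun x _ => ?_)
    (by simp) (ae_of_all _ fun x _ => ?_)
  · have h₁ := ha n
    have h₂ := hδ n
    exact Continuous.aestronglyMeasurable (by fun_prop)
  · rw [norm_mul, Complex.norm_real, Real.norm_eq_abs]
    exact (mul_le_of_le_one_right (norm_nonneg _) (Real.abs_sin_le_one _)).trans (hM n x)
  · exact (hlim x).mul ((Complex.continuous_ofReal.tendsto _).comp
      ((Real.continuous_sin.tendsto _).comp (hδlim x)))

theorem tendsto_integral_mul_sin_phase_add (hs0 : 0 < s) (hs1 : s < 1)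
    (ha : ∀ n, Continuous (a n)) (ha₀ : Continuous a₀) (hδ : ∀ n, Continuous (δ n))
    (hd : Continuous d) (hM : ∀ n x, ‖a n x‖ ≤ M)
    (hlim : ∀ x, Tendsto (fun n => a n x) atTop (𝓝 (a₀ x)))
    (hδlim : ∀ x, Tendsto (fun n => δ n x) atTop (𝓝 (d x))) :
    Tendsto (fun n : ℕ => ∫ x in (0:ℝ)..(2 * Real.pi),
      a n x * (Real.sin (2 * n * phase s x + δ n x) : ℂ)) atTop (𝓝 0) := by
  have hφ := continuous_phase (s := s)
  have hM₀ : ∀ x, ‖a₀ x‖ ≤ M := fun x =>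
    le_of_tendsto (hlim x).norm (Eventually.of_forall fun n => hM n x)
  have hbound : ∀ (b : ℂ) (y : ℝ), ‖b‖ ≤ M → ‖b * (Real.sin y : ℂ)‖ ≤ M := fun b y hb => by
    rw [norm_mul, Complex.norm_real, Real.norm_eq_abs]
    exact (mul_le_of_le_one_right (norm_nonneg _) (Real.abs_sin_le_one _)).trans hb
  have hdiff : Tendsto (fun n : ℕ => ∫ x in (0:ℝ)..(2 * Real.pi),
      (a n x * (Real.sin (2 * n * phase s x + δ n x) : ℂ)
        - a₀ x * (Real.sin (2 * n * phase s x + d x) : ℂ))) atTop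
      (𝓝 (∫ _ in (0:ℝ)..(2 * Real.pi), (0 : ℂ))) := by
    refine intervalIntegral.tendsto_integral_filter_of_dominated_convergence (fun _ => M + M)
      (Eventually.of_forall fun n => ?_) (Eventually.of_forall fun n => ae_of_all _ fun x _ => ?_)
      (by simp) (ae_of_all _ fun x _ => ?_)
    · have h₁ := ha n
      have h₂ := hδ n
      exact Continuous.aestronglyMeasurable (by fun_prop)
    · exact (norm_sub_le _ _).trans (add_le_add (hbound _ _ (hM n x)) (hbound _ _ (hM₀ x)))
    · have h₁ : Tendsto (fun n => ‖a n x - a₀ x‖) atTop (𝓝 0) :=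
        tendsto_iff_norm_sub_tendsto_zero.1 (hlim x)
      have h₂ : Tendsto (fun n => |δ n x - d x|) atTop (𝓝 0) :=
        tendsto_iff_norm_sub_tendsto_zero.1 (hδlim x)
      have h₃ := h₁.add (h₂.const_mul M)
      rw [mul_zero, add_zero] at h₃
      refine squeeze_zero_norm (fun n => ?_) h₃
      rw [show a n x * (Real.sin (2 * n * phase s x + δ n x) : ℂ)
          - a₀ x * (Real.sin (2 * n * phase s x + d x) : ℂ)
        = (a n x - a₀ x) * (Real.sin (2 * n * phase s x + δ n x) : ℂ)
          + a₀ x * ((Real.sin (2 * n * phase s x + δ n x)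
            - Real.sin (2 * n * phase s x + d x) : ℝ) : ℂ) by push_cast; ring]
      refine (norm_add_le _ _).trans (add_le_add ?_ ?_)
      · rw [norm_mul, Complex.norm_real, Real.norm_eq_abs]
        exact mul_le_of_le_one_right (norm_nonneg _) (Real.abs_sin_le_one _)
      · rw [norm_mul, Complex.norm_real, Real.norm_eq_abs]
        refine mul_le_mul (hM₀ x) ?_ (abs_nonneg _) ((norm_nonneg _).trans (hM₀ x))
        simpa using Real.abs_sin_sub_sin_le (2 * n * phase s x + δ n x) (2 * n * phase s x + d x)
  have h := hdiff.add (tendsto_integral_sin_phase hs0 hs1 ha₀ hd)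
  rw [intervalIntegral.integral_zero, add_zero] at h
  refine h.congr fun n => ?_
  have h₁ := ha n
  have h₂ := hδ n
  rw [← intervalIntegral.integral_add (Continuous.intervalIntegrable (by fun_prop) _ _)
    (Continuous.intervalIntegrable (by fun_prop) _ _)]
  simp

end Perturbation

theorem eval_T_mul_cos (hs0 : 0 < s) (hs1 : s < 1) (n : ℕ) (θ : ℝ) :
    (Polynomial.Chebyshev.T ℝ (n : ℤ)).eval (s * Real.cos θ) = Real.cos (n * phase s θ) := by
  rw [← cos_phase hs0 hs1, Polynomial.Chebyshev.T_real_cos]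
  simp

theorem eval_U_mul_cos (hs0 : 0 < s) (hs1 : s < 1) (n : ℕ) (θ : ℝ) :
    (Polynomial.Chebyshev.U ℝ ((n : ℤ) - 1)).eval (s * Real.cos θ)
      = Real.sin (n * phase s θ) / Real.sin (phase s θ) := by
  rw [eq_div_iff (sin_phase_pos hs0 hs1 θ).ne', ← cos_phase hs0 hs1,
    Polynomial.Chebyshev.U_real_cos]
  simp

/-- The rescaled phase increment `n (φ(θ + ξ/n) - φ(θ))`. -/
noncomputable def phaseIncr (s ξ : ℝ) (n : ℕ) (θ : ℝ) : ℝ :=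
  n * (phase s (θ + ξ / n) - phase s θ)

theorem continuous_phaseIncr (ξ : ℝ) (n : ℕ) : Continuous (phaseIncr s ξ n) := by
  have := continuous_phase (s := s)
  unfold phaseIncr
  fun_prop

theorem tendsto_div_natCast (ξ : ℝ) : Tendsto (fun n : ℕ => ξ / n) atTop (𝓝 0) :=
  tendsto_const_nhds.div_atTop tendsto_natCast_atTop_atTop

theorem tendsto_phaseIncr (hs0 : 0 < s) (hs1 : s < 1) (ξ θ : ℝ) :
    Tendsto (fun n => phaseIncr s ξ n θ) atTop (𝓝 (ξ * phaseDeriv s θ)) := by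
  have hline : HasDerivAt (fun t : ℝ => phase s (θ + ξ * t)) (ξ * phaseDeriv s θ) 0 := by
    have hlin : HasDerivAt (fun t : ℝ => θ + ξ * t) ξ 0 := by
      simpa using ((hasDerivAt_id (0 : ℝ)).const_mul ξ).const_add θ
    have hphase : HasDerivAt (phase s) (phaseDeriv s θ) (θ + ξ * 0) := by
      simpa using hasDerivAt_phase hs0 hs1 θ
    exact (hphase.comp 0 hlin).congr_deriv (mul_comm _ _)
  have hinv : Tendsto (fun n : ℕ => (n : ℝ)⁻¹) atTop (𝓝[≠] 0) :=
    tendsto_nhdsWithin_iff.2 ⟨tendsto_inv_atTop_nhds_zero_nat,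
      (eventually_gt_atTop 0).mono fun n hn => by simp; omega⟩
  refine ((hasDerivAt_iff_tendsto_slope_zero.1 hline).comp hinv).congr fun n => ?_
  simp [phaseIncr, div_eq_mul_inv]

theorem cos_mul_sin_eq (x y : ℝ) :
    Real.cos x * Real.sin y = (Real.sin (x + y) - Real.sin (x - y)) / 2 := by
  rw [Real.sin_add, Real.sin_sub]
  ring

/-- The weight `e^{ikθ} / (2 sin φ(θ + h))`. -/
noncomputable def weight (s : ℝ) (k : ℤ) (h θ : ℝ) : ℂ :=
  Complex.exp (Complex.I * k * θ) * ((2 * Real.sin (phase s (θ + h)))⁻¹ : ℝ)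

theorem continuous_weight (hs0 : 0 < s) (hs1 : s < 1) (k : ℤ) :
    Continuous fun p : ℝ × ℝ => weight s k p.1 p.2 := by
  have := continuous_phase (s := s)
  unfold weight
  refine Continuous.mul (by fun_prop) (Complex.continuous_ofReal.comp ?_)
  exact Continuous.inv₀ (by fun_prop)
    fun p => mul_ne_zero two_ne_zero (sin_phase_pos hs0 hs1 _).ne'

theorem norm_weight_le (hs0 : 0 < s) (hs1 : s < 1) (k : ℤ) (h θ : ℝ) :
    ‖weight s k h θ‖ ≤ (2 * Real.sqrt (1 - s ^ 2))⁻¹ := by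
  have hexp : ‖Complex.exp (Complex.I * k * θ)‖ = 1 := by
    rw [show Complex.I * k * θ = ((k * θ : ℝ) : ℂ) * Complex.I by push_cast; ring,
      Complex.norm_exp_ofReal_mul_I]
  have hpos := sin_phase_pos hs0 hs1 (θ + h)
  rw [weight, norm_mul, hexp, one_mul, Complex.norm_real, Real.norm_eq_abs,
    abs_of_pos (by positivity)]
  have := sqrt_one_sub_sq_pos hs0 hs1
  have := sqrt_le_sin_phase hs0 (θ + h)
  gcongr

theorem Bnk_eq (hs0 : 0 < s) (hs1 : s < 1) (k : ℤ) (ξ : ℝ) (n : ℕ) :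
    Bnk s k ξ n = ((1 / (2 * Real.pi) : ℝ) : ℂ) *
      ((∫ θ in (0:ℝ)..(2 * Real.pi),
          weight s k 0 θ * (Real.sin (2 * n * phase s θ + phaseIncr s ξ n θ) : ℂ))
        - ∫ θ in (0:ℝ)..(2 * Real.pi), weight s k 0 θ * (Real.sin (phaseIncr s ξ n θ) : ℂ)) := by
  have hw : Continuous (weight s k 0) :=
    (continuous_weight hs0 hs1 k).comp (Continuous.prodMk_right 0)
  have hφ := continuous_phase (s := s)
  have hδ := continuous_phaseIncr (s := s) ξ n
  rw [Bnk, ← intervalIntegral.integral_sub (Continuous.intervalIntegrable (by fun_prop) _ _)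
    (Continuous.intervalIntegrable (by fun_prop) _ _)]
  congr 1
  refine intervalIntegral.integral_congr fun θ _ => ?_
  simp only [eval_T_mul_cos hs0 hs1, eval_U_mul_cos hs0 hs1, weight, add_zero]
  rw [mul_assoc, ← Complex.ofReal_mul, mul_div_assoc', cos_mul_sin_eq,
    show n * phase s (θ + ξ / n) + n * phase s θ = 2 * n * phase s θ + phaseIncr s ξ n θ by
      rw [phaseIncr]; ring,
    show n * phase s (θ + ξ / n) - n * phase s θ = phaseIncr s ξ n θ by rw [phaseIncr]; ring]
  push_cast
  ring

theorem Cnk_eq (hs0 : 0 < s) (hs1 : s < 1) (k : ℤ) (ξ : ℝ) (n : ℕ) :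
    Cnk s k ξ n = ((1 / (2 * Real.pi) : ℝ) : ℂ) *
      ((∫ θ in (0:ℝ)..(2 * Real.pi),
          weight s k (ξ / n) θ * (Real.sin (2 * n * phase s θ + phaseIncr s ξ n θ) : ℂ))
        + ∫ θ in (0:ℝ)..(2 * Real.pi),
          weight s k (ξ / n) θ * (Real.sin (phaseIncr s ξ n θ) : ℂ)) := by
  have hw : Continuous (weight s k (ξ / n)) :=
    (continuous_weight hs0 hs1 k).comp (Continuous.prodMk_right (ξ / n : ℝ))
  have hφ := continuous_phase (s := s)
  have hδ := continuous_phaseIncr (s := s) ξ n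
  rw [Cnk, ← intervalIntegral.integral_add (Continuous.intervalIntegrable (by fun_prop) _ _)
    (Continuous.intervalIntegrable (by fun_prop) _ _)]
  congr 1
  refine intervalIntegral.integral_congr fun θ _ => ?_
  simp only [eval_T_mul_cos hs0 hs1, eval_U_mul_cos hs0 hs1, weight]
  rw [mul_assoc, ← Complex.ofReal_mul, div_mul_eq_mul_div, mul_comm (Real.sin _) (Real.cos _),
    cos_mul_sin_eq,
    show n * phase s θ + n * phase s (θ + ξ / n) = 2 * n * phase s θ + phaseIncr s ξ n θ by
      rw [phaseIncr]; ring,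
    show n * phase s θ - n * phase s (θ + ξ / n) = -phaseIncr s ξ n θ by rw [phaseIncr]; ring,
    Real.sin_neg]
  push_cast
  ring

theorem integral_weight_mul_sin_half (hs0 : 0 < s) (k : ℤ) (ξ : ℝ) :
    ∫ θ in (0:ℝ)..Real.pi, weight s k 0 θ * (Real.sin (ξ * phaseDeriv s θ) : ℂ)
      = 1 / 2 * ∫ x in (-s)..s, ek s k x *
          Complex.ofReal (Real.sin (ξ * Real.sqrt (s ^ 2 - x ^ 2) / Real.sqrt (1 - x ^ 2))) *
          Complex.ofReal ((Real.sqrt ((1 - x ^ 2) * (s ^ 2 - x ^ 2)))⁻¹) := by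
  have himage : (fun θ => s * Real.cos θ) '' Ioo 0 Real.pi = Ioo (-s) s := by
    ext x
    constructor
    · rintro ⟨θ, hθ, rfl⟩
      have hsin := Real.sin_pos_of_mem_Ioo hθ
      have hsq := Real.sin_sq_add_cos_sq θ
      have h := abs_lt.1 (abs_lt_of_sq_lt_sq (a := Real.cos θ) (b := 1) (by nlinarith) one_pos.le)
      constructor <;> nlinarith
    · rintro ⟨h₁, h₂⟩
      have h₃ : -1 < x / s := by rw [lt_div_iff₀ hs0]; linarith
      have h₄ : x / s < 1 := by rw [div_lt_iff₀ hs0]; linarith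
      refine ⟨Real.arccos (x / s), ⟨Real.arccos_pos.2 h₄, Real.arccos_lt_pi.2 h₃⟩, ?_⟩
      simp only [Real.cos_arccos h₃.le h₄.le]
      field_simp
  rw [intervalIntegral.integral_of_le Real.pi_pos.le, intervalIntegral.integral_of_le (by linarith),
    integral_Ioc_eq_integral_Ioo, integral_Ioc_eq_integral_Ioo, ← himage,
    integral_image_eq_integral_abs_deriv_smul measurableSet_Ioo
      (fun θ _ => ((Real.hasDerivAt_cos θ).const_mul s).hasDerivWithinAt)
      (fun x hx y hy hxy => Real.injOn_cos (Ioo_subset_Icc_self hx) (Ioo_subset_Icc_self hy)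
        (mul_left_cancel₀ hs0.ne' hxy)), ← integral_const_mul]
  refine setIntegral_congr_fun measurableSet_Ioo fun θ hθ => ?_
  have hsin := Real.sin_pos_of_mem_Ioo hθ
  have hsq : s ^ 2 - (s * Real.cos θ) ^ 2 = (s * Real.sin θ) ^ 2 := by
    rw [mul_pow, mul_pow, Real.sin_sq]
    ring
  have hnonneg : 0 ≤ s ^ 2 - (s * Real.cos θ) ^ 2 := hsq ▸ sq_nonneg _
  have hsqrt : Real.sqrt (s ^ 2 - (s * Real.cos θ) ^ 2) = s * Real.sin θ := by
    rw [hsq, Real.sqrt_sq (mul_pos hs0 hsin).le]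
  have hek : ek s k (s * Real.cos θ) = Complex.exp (Complex.I * k * θ) := by
    rw [ek, mul_div_cancel_left₀ _ hs0.ne', Real.arccos_cos hθ.1.le hθ.2.le]
  have hs_ne : (s : ℂ) ≠ 0 := by exact_mod_cast hs0.ne'
  have hsin_ne : (Real.sin θ : ℂ) ≠ 0 := by exact_mod_cast hsin.ne'
  have habs : |s * -Real.sin θ| = s * Real.sin θ := by
    rw [mul_neg, abs_neg, abs_of_pos (mul_pos hs0 hsin)]
  simp only [hek, habs]
  rw [Real.sqrt_mul' _ hnonneg, hsqrt, weight, add_zero, sin_phase, phaseDeriv, mul_div_assoc,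
    Complex.real_smul]
  simp only [Complex.ofReal_inv, Complex.ofReal_mul, mul_inv, Complex.ofReal_ofNat]
  field_simp

theorem integral_weight_mul_sin (hs0 : 0 < s) (hs1 : s < 1) (k : ℤ) (ξ : ℝ) :
    ∫ θ in (0:ℝ)..(2 * Real.pi), weight s k 0 θ * (Real.sin (ξ * phaseDeriv s θ) : ℂ)
      = ((1 - (-1 : ℝ) ^ k : ℝ) : ℂ) *
        ∫ θ in (0:ℝ)..Real.pi, weight s k 0 θ * (Real.sin (ξ * phaseDeriv s θ) : ℂ) := by
  have hw : Continuous (weight s k 0) :=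
    (continuous_weight hs0 hs1 k).comp (Continuous.prodMk_right 0)
  have hd := continuous_phaseDeriv hs0 hs1
  have hc : Continuous fun θ => weight s k 0 θ * (Real.sin (ξ * phaseDeriv s θ) : ℂ) := by
    fun_prop
  rw [← intervalIntegral.integral_add_adjacent_intervals (hc.intervalIntegrable 0 Real.pi)
    (hc.intervalIntegrable Real.pi (2 * Real.pi))]
  have hshift := intervalIntegral.integral_comp_add_right (a := 0) (b := Real.pi)
    (fun θ => weight s k 0 θ * (Real.sin (ξ * phaseDeriv s θ) : ℂ)) Real.pi
  rw [zero_add, ← two_mul] at hshift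
  have hanti : ∀ θ, weight s k 0 (θ + Real.pi) * (Real.sin (ξ * phaseDeriv s (θ + Real.pi)) : ℂ)
      = -((-1 : ℝ) ^ k : ℝ) * (weight s k 0 θ * (Real.sin (ξ * phaseDeriv s θ) : ℂ)) := by
    intro θ
    have hexp : Complex.exp (Complex.I * k * (θ + Real.pi : ℝ))
        = ((-1 : ℝ) ^ k : ℝ) * Complex.exp (Complex.I * k * θ) := by
      push_cast
      rw [mul_add, Complex.exp_add, mul_comm, show Complex.I * k * Real.pi
        = k * (Real.pi * Complex.I) by ring, Complex.exp_int_mul, Complex.exp_pi_mul_I]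
    rw [weight, weight, hexp, add_zero, add_zero, sin_phase, sin_phase, phaseDeriv, phaseDeriv,
      Real.cos_add_pi, Real.sin_add_pi, mul_neg, mul_neg, neg_sq, neg_div, mul_neg, Real.sin_neg]
    push_cast
    ring
  rw [← hshift, intervalIntegral.integral_congr fun θ _ => hanti θ,
    intervalIntegral.integral_const_mul]
  push_cast
  ring

end ChebyshevPhase

open ChebyshevPhase in
/-- The limits of `B_{n,k}(ξ)` and `C_{n,k}(ξ)` as `n → ∞`. -/
theorem Bnk_Cnk_limit (s : ℝ) (hs0 : 0 < s) (hs1 : s < 1) (k : ℤ) (ξ : ℝ) :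
    Filter.Tendsto (fun n : ℕ => Bnk s k ξ n) Filter.atTop
      (nhds (-((((1 - (-1 : ℝ) ^ k) / (4 * Real.pi) : ℝ) : ℂ) *
        ∫ x in (-s)..s,
          ek s k x *
            Complex.ofReal (Real.sin (ξ * Real.sqrt (s ^ 2 - x ^ 2) / Real.sqrt (1 - x ^ 2))) *
            Complex.ofReal ((Real.sqrt ((1 - x ^ 2) * (s ^ 2 - x ^ 2)))⁻¹)))) ∧
    Filter.Tendsto (fun n : ℕ => Cnk s k ξ n) Filter.atTop
      (nhds ((((1 - (-1 : ℝ) ^ k) / (4 * Real.pi) : ℝ) : ℂ) *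
        ∫ x in (-s)..s,
          ek s k x *
            Complex.ofReal (Real.sin (ξ * Real.sqrt (s ^ 2 - x ^ 2) / Real.sqrt (1 - x ^ 2))) *
            Complex.ofReal ((Real.sqrt ((1 - x ^ 2) * (s ^ 2 - x ^ 2)))⁻¹))) := by
  set J : ℂ := ∫ x in (-s)..s,
    ek s k x *
      Complex.ofReal (Real.sin (ξ * Real.sqrt (s ^ 2 - x ^ 2) / Real.sqrt (1 - x ^ 2))) *
      Complex.ofReal ((Real.sqrt ((1 - x ^ 2) * (s ^ 2 - x ^ 2)))⁻¹)
  have hw := continuous_weight hs0 hs1 k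
  have hwcont : ∀ h, Continuous (weight s k h) := fun h => hw.comp (Continuous.prodMk_right h)
  have hd : Continuous fun θ => ξ * phaseDeriv s θ :=
    (continuous_phaseDeriv hs0 hs1).const_mul ξ
  have hwlim : ∀ θ, Filter.Tendsto (fun n : ℕ => weight s k (ξ / n) θ) Filter.atTop
      (nhds (weight s k 0 θ)) := fun θ =>
    ((hw.comp (Continuous.prodMk_left θ)).tendsto 0).comp (tendsto_div_natCast ξ)
  have hlim : ∫ θ in (0:ℝ)..(2 * Real.pi), weight s k 0 θ * (Real.sin (ξ * phaseDeriv s θ) : ℂ)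
      = ((1 - (-1 : ℝ) ^ k : ℝ) : ℂ) * (1 / 2 * J) := by
    rw [integral_weight_mul_sin hs0 hs1, integral_weight_mul_sin_half hs0]
  have hpi : (Real.pi : ℂ) ≠ 0 := by exact_mod_cast Real.pi_ne_zero
  constructor
  · have h := ((tendsto_integral_mul_sin_phase_add hs0 hs1 (fun _ => hwcont 0) (hwcont 0)
      (continuous_phaseIncr ξ) hd (fun _ => norm_weight_le hs0 hs1 k 0)
      (fun _ => tendsto_const_nhds) (tendsto_phaseIncr hs0 hs1 ξ)).sub
      (tendsto_integral_mul_sin (fun _ => hwcont 0) (continuous_phaseIncr ξ)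
      (fun _ => norm_weight_le hs0 hs1 k 0) (fun _ => tendsto_const_nhds)
      (tendsto_phaseIncr hs0 hs1 ξ) 0 (2 * Real.pi))).const_mul ((1 / (2 * Real.pi) : ℝ) : ℂ)
    rw [hlim] at h
    simp only [Bnk_eq hs0 hs1]
    convert h using 2
    push_cast
    field_simp
    ring
  · have h := ((tendsto_integral_mul_sin_phase_add hs0 hs1 (fun n : ℕ => hwcont (ξ / n)) (hwcont 0)
      (continuous_phaseIncr ξ) hd (fun _ => norm_weight_le hs0 hs1 k _)
      hwlim (tendsto_phaseIncr hs0 hs1 ξ)).add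
      (tendsto_integral_mul_sin (fun n : ℕ => hwcont (ξ / n)) (continuous_phaseIncr ξ)
      (fun _ => norm_weight_le hs0 hs1 k _) hwlim
      (tendsto_phaseIncr hs0 hs1 ξ) 0 (2 * Real.pi))).const_mul ((1 / (2 * Real.pi) : ℝ) : ℂ)
    rw [hlim] at h
    simp only [Cnk_eq hs0 hs1]
    convert h using 2
    push_cast
    field_simp
    ring
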